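/- arXiv:1503.01251 — 2 statements merged into one kernel-verified Lean document; each statement's English description precedes it below -/
import Mathlib

section
/- Let V be a finite-dimensional real vector space and F₁, F₂ real endomorphisms of V satisfying F₁² - F₂² = Id, F₁∘F₂ + F₂∘F₁ = 0, and F₁∘F₂ = 0 (the split condition). Then: F₂∘F₁ = 0; F₁³ = F₁; F₂³ = -F₂; the endomorphism Φ = F₁² + F₂² satisfies Φ² = Id; V = P ⊕ Q where P and Q are the +1 and -1 eigenspaces of Φ; and P = range(F₁²) = range(F₁) = ker(F₂), Q = range(F₂²) = range(F₂) = ker(F₁), with F₁²|_P = Id and F₂²|_Q = -Id. -/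
noncomputable section

open TensorProduct

attribute [local instance 3000] TensorProduct.addCommMonoid TensorProduct.leftModule

/-- The "big tangent space" `V ⊕ V*`. -/
abbrev Big (V : Type) [AddCommGroup V] [Module ℝ V] : Type := V × Module.Dual ℝ V

variable (V : Type) [AddCommGroup V] [Module ℝ V]

/-- The pairing metric `g((X,α),(Y,β)) = (α Y + β X)/2` on `V ⊕ V*`. -/
def gP : Big V →ₗ[ℝ] Big V →ₗ[ℝ] ℝ :=
  LinearMap.mk₂ ℝ (fun u v => (u.2 v.1 + v.2 u.1) / 2)
    (fun m₁ m₂ n => by simp; ring)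
    (fun c m n => by simp; ring)
    (fun m n₁ n₂ => by simp; ring)
    (fun c m n => by simp; ring)

/-- A generalized almost para-complex structure on `V`. -/
def IsGenParaCx (F : Big V →ₗ[ℝ] Big V) : Prop :=
  F ∘ₗ F = LinearMap.id ∧ ∀ u v, gP V (F u) v = - gP V u (F v)

/-- A generalized almost complex structure on `V`. -/
def IsGenCx (J : Big V →ₗ[ℝ] Big V) : Prop :=
  J ∘ₗ J = - LinearMap.id ∧ ∀ u v, gP V (J u) v = - gP V u (J v)

/-- The bilinear form `γ(α,β) = -2 g(𝓕(0,α), 𝓙(0,β))` on `V*`. -/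
def gammaOf (F J : Big V →ₗ[ℝ] Big V) (α β : Module.Dual ℝ V) : ℝ :=
  -2 * gP V (F (0, α)) (J (0, β))

/-- A generalized almost para-Hermitian structure on `V`: a commuting pair of a
generalized almost para-complex structure and a generalized almost complex structure
whose associated bilinear form `γ` on `V*` is nondegenerate. -/
def IsGAPH (F J : Big V →ₗ[ℝ] Big V) : Prop :=
  IsGenParaCx V F ∧ IsGenCx V J ∧ F ∘ₗ J = J ∘ₗ F ∧
    ∀ α, (∀ β, gammaOf V F J α β = 0) → α = 0

/-- Complexification of `V`. -/
abbrev Vc : Type := ℂ ⊗[ℝ] V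

/-- Complexification of the big space `V ⊕ V*`. -/
abbrev Bc : Type := ℂ ⊗[ℝ] Big V

/-- The projection `(V ⊕ V*)^ℂ → V^ℂ`. -/
def prV : Bc V →ₗ[ℂ] Vc V := LinearMap.baseChange ℂ (LinearMap.fst ℝ V (Module.Dual ℝ V))

/-- The inclusion `V^ℂ → (V ⊕ V*)^ℂ`, `X ↦ (X, 0)`. -/
def inV : Vc V →ₗ[ℂ] Bc V := LinearMap.baseChange ℂ (LinearMap.inl ℝ V (Module.Dual ℝ V))

/-- The complexified pairing metric on `(V ⊕ V*)^ℂ`. -/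
def gc : Bc V →ₗ[ℂ] Bc V →ₗ[ℂ] ℂ := LinearMap.BilinForm.baseChange ℂ (gP V)

/-- Complex-bilinear extension of a bilinear form on `V` to `V^ℂ`. -/
def bcB (B : LinearMap.BilinForm ℝ V) : Vc V →ₗ[ℂ] Vc V →ₗ[ℂ] ℂ :=
  LinearMap.BilinForm.baseChange ℂ B

/-- The `μ`-eigenspace of an endomorphism of `(V ⊕ V*)^ℂ`. -/
def eigSp (T : Bc V →ₗ[ℂ] Bc V) (μ : ℂ) : Submodule ℂ (Bc V) where
  carrier := {u | T u = μ • u}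
  add_mem' := by
    intro a b ha hb
    simp only [Set.mem_setOf_eq, map_add] at *
    rw [ha, hb, smul_add]
  zero_mem' := by simp
  smul_mem' := by
    intro c u hu
    simp only [Set.mem_setOf_eq, map_smul] at *
    rw [hu, smul_comm]

/-- The `i`-eigenspace of the complexification of an endomorphism of `V ⊕ V*`. -/
def Hsp (H : Big V →ₗ[ℝ] Big V) : Submodule ℂ (Bc V) :=
  eigSp V (LinearMap.baseChange ℂ H) Complex.I

/-- The `+1`-eigenspace of the complexification of an endomorphism of `V ⊕ V*`. -/
def Fplus (F : Big V →ₗ[ℝ] Big V) : Submodule ℂ (Bc V) :=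
  eigSp V (LinearMap.baseChange ℂ F) 1

/-- The `-1`-eigenspace of the complexification of an endomorphism of `V ⊕ V*`. -/
def Fminus (F : Big V →ₗ[ℝ] Big V) : Submodule ℂ (Bc V) :=
  eigSp V (LinearMap.baseChange ℂ F) (-1)

/-- The graph `{(X, ψ^ℂ(X,·) + i γ₀^ℂ(X,·)) : X ∈ V^ℂ}` inside `(V ⊕ V*)^ℂ`.
An element `u = (X, α)` lies on the graph iff `α(Y) = ψ^ℂ(X,Y) + i γ₀^ℂ(X,Y)` for all
`Y ∈ V^ℂ`; the value `α(Y)` is expressed canonically as `2 g^ℂ(u, (Y,0))`. -/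
def graphSet (γ₀ ψ : LinearMap.BilinForm ℝ V) : Set (Bc V) :=
  {u | ∀ Y : Vc V, 2 * gc V u (inV V Y) =
      bcB V ψ (prV V u) Y + Complex.I * bcB V γ₀ (prV V u) Y}

/-- Complex conjugation of `(V ⊕ V*)^ℂ` with respect to the real form `V ⊕ V*`. -/
def conjMap : Bc V →ₗ[ℝ] Bc V := LinearMap.rTensor (Big V) Complex.conjAe.toLinearMap

/-- The complex conjugate of a complex subspace of `(V ⊕ V*)^ℂ` (the image of the
subspace under conjugation; taking the `ℂ`-span does not enlarge the image, since the
image of a complex subspace under conjugation is again a complex subspace). -/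
def conjSub (S : Submodule ℂ (Bc V)) : Submodule ℂ (Bc V) :=
  Submodule.span ℂ (conjMap V '' (S : Set (Bc V)))

noncomputable instance (S : Submodule ℂ (Bc V)) : AddCommGroup ↥S :=
  Module.addCommMonoidToAddCommGroup ℂ

/-- A `g`-isotropic subspace of `(V ⊕ V*)^ℂ`. -/
def IsIsotropic (S : Submodule ℂ (Bc V)) : Prop := ∀ u ∈ S, ∀ v ∈ S, gc V u v = 0

/-- A maximal `g`-isotropic subspace of `(V ⊕ V*)^ℂ`: a `g`-isotropic subspace of
complex dimension `dim V`. -/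
def MaxIsotropic (S : Submodule ℂ (Bc V)) : Prop :=
  IsIsotropic V S ∧ Module.finrank ℂ S = Module.finrank ℝ V

/-- The endomorphism of `V^ℂ` induced by an endomorphism `A` of `V ⊕ V*` via `τ`:
`X ↦ pr_{V^ℂ} (A^ℂ (τ X))`. -/
def Fop (A : Big V →ₗ[ℝ] Big V) (τ : Vc V →ₗ[ℂ] Bc V) : Vc V → Vc V :=
  fun X => prV V (LinearMap.baseChange ℂ A (τ X))

/-- The canonical (real) inclusion `V → V^ℂ`. -/
def realIncl : V →ₗ[ℝ] Vc V := TensorProduct.mk ℝ ℂ V 1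

/-- The canonical (real) inclusion `V ⊕ V* → (V ⊕ V*)^ℂ`. -/
def realInclB : Big V →ₗ[ℝ] Bc V := TensorProduct.mk ℝ ℂ (Big V) 1

/-- The B-field transformation `(X, α) ↦ (X, α + B(X,·))` of `V ⊕ V*`. -/
def Bfield (B : LinearMap.BilinForm ℝ V) : Big V →ₗ[ℝ] Big V :=
  LinearMap.prod (LinearMap.fst ℝ V (Module.Dual ℝ V))
    (LinearMap.snd ℝ V (Module.Dual ℝ V) + B ∘ₗ LinearMap.fst ℝ V (Module.Dual ℝ V))

/-- `(X, α) ↦ (F X, -α ∘ F)`. -/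
def genF (F : V →ₗ[ℝ] V) : Big V →ₗ[ℝ] Big V := F.prodMap (- F.dualMap)

/-- `(X, α) ↦ (♯ α, -γ₀(X,·))`. -/
def genH (γ₀ : LinearMap.BilinForm ℝ V) (sharp : Module.Dual ℝ V →ₗ[ℝ] V) :
    Big V →ₗ[ℝ] Big V :=
  LinearMap.prod (sharp ∘ₗ LinearMap.snd ℝ V (Module.Dual ℝ V))
    (- (γ₀ ∘ₗ LinearMap.fst ℝ V (Module.Dual ℝ V)))

/-- The projection `(1/4)(Id + 𝓕^ℂ) ∘ (Id - i 𝓗^ℂ)` onto `𝐇₊`, as a function. -/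
def prHplus (F H : Big V →ₗ[ℝ] Big V) (u : Bc V) : Bc V :=
  ((1 : ℂ)/4) • ((u - Complex.I • LinearMap.baseChange ℂ H u) +
    LinearMap.baseChange ℂ F (u - Complex.I • LinearMap.baseChange ℂ H u))

/-- The projection `(1/4)(Id - 𝓕^ℂ) ∘ (Id - i 𝓗^ℂ)` onto `𝐇₋`, as a function. -/
def prHminus (F H : Big V →ₗ[ℝ] Big V) (u : Bc V) : Bc V :=
  ((1 : ℂ)/4) • ((u - Complex.I • LinearMap.baseChange ℂ H u) -
    LinearMap.baseChange ℂ F (u - Complex.I • LinearMap.baseChange ℂ H u))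

/-- The inclusion `W ⊕ V* → V ⊕ V*` over a subspace `W ⊆ V`. -/
def bigIncl (W : Submodule ℝ V) : (↥W × Module.Dual ℝ V) →ₗ[ℝ] Big V :=
  (W.subtype).prodMap LinearMap.id

/-- The restriction `W ⊕ V* → W ⊕ W*`, restricting functionals to `W`. -/
def bigRes (W : Submodule ℝ V) : (↥W × Module.Dual ℝ V) →ₗ[ℝ] Big ↥W :=
  LinearMap.prodMap LinearMap.id (W.subtype.dualMap)

/-- The pullback `ι*U = {(X, η∘ι) : X ∈ W^ℂ, (X, η) ∈ U}` of a subspace of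
`(V ⊕ V*)^ℂ` to `(W ⊕ W*)^ℂ`. -/
def pullback (W : Submodule ℝ V) (U : Submodule ℂ (Bc V)) : Submodule ℂ (Bc ↥W) :=
  Submodule.map (LinearMap.baseChange ℂ (bigRes V W))
    (Submodule.comap (LinearMap.baseChange ℂ (bigIncl V W)) U)

/-- Restriction of a bilinear form on `V` to a subspace `W`. -/
def resB (W : Submodule ℝ V) (B : LinearMap.BilinForm ℝ V) : LinearMap.BilinForm ℝ ↥W :=
  B.compl₁₂ W.subtype W.subtype

/-- The `μ`-eigenspace of a real endomorphism of `V`. -/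
def eigSpR (F : V →ₗ[ℝ] V) (μ : ℝ) : Submodule ℝ V where
  carrier := {u | F u = μ • u}
  add_mem' := by
    intro a b ha hb
    simp only [Set.mem_setOf_eq, map_add] at *
    rw [ha, hb, smul_add]
  zero_mem' := by simp
  smul_mem' := by
    intro c u hu
    simp only [Set.mem_setOf_eq, map_smul] at *
    rw [hu, smul_comm]

theorem mem_eigSpR (V : Type) [AddCommGroup V] [Module ℝ V] (F : V →ₗ[ℝ] V) (μ : ℝ) (x : V) :
    x ∈ eigSpR V F μ ↔ F x = μ • x := Iff.rfl

/-- If `F₁, F₂ ∈ End(V)` satisfy `F₁² - F₂² = Id`,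
`F₁F₂ + F₂F₁ = 0` and the split condition `F₁F₂ = 0`, then `F₂F₁ = 0`, `F₁³ = F₁`,
`F₂³ = -F₂`, `Φ = F₁² + F₂²` satisfies `Φ² = Id`, `V = P ⊕ Q` for the `±1`-eigenspaces
`P, Q` of `Φ`, and `P = im F₁² = im F₁ = ker F₂`, `Q = im F₂² = im F₂ = ker F₁`, with
`F₁²|_P = Id` and `F₂²|_Q = -Id`. -/
theorem split_structure (V : Type) [AddCommGroup V] [Module ℝ V]
    [FiniteDimensional ℝ V]
    (F₁ F₂ : V →ₗ[ℝ] V)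
    (h1 : F₁ ∘ₗ F₁ - F₂ ∘ₗ F₂ = LinearMap.id)
    (h2 : F₁ ∘ₗ F₂ + F₂ ∘ₗ F₁ = 0)
    (h3 : F₁ ∘ₗ F₂ = 0) :
    (F₂ ∘ₗ F₁ = 0) ∧
    (F₁ ∘ₗ F₁ ∘ₗ F₁ = F₁) ∧
    (F₂ ∘ₗ F₂ ∘ₗ F₂ = - F₂) ∧
    ((F₁ ∘ₗ F₁ + F₂ ∘ₗ F₂) ∘ₗ (F₁ ∘ₗ F₁ + F₂ ∘ₗ F₂) = LinearMap.id) ∧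
    IsCompl (eigSpR V (F₁ ∘ₗ F₁ + F₂ ∘ₗ F₂) 1) (eigSpR V (F₁ ∘ₗ F₁ + F₂ ∘ₗ F₂) (-1)) ∧
    (eigSpR V (F₁ ∘ₗ F₁ + F₂ ∘ₗ F₂) 1 = LinearMap.range (F₁ ∘ₗ F₁)) ∧
    (LinearMap.range (F₁ ∘ₗ F₁) = LinearMap.range F₁) ∧
    (LinearMap.range F₁ = LinearMap.ker F₂) ∧
    (eigSpR V (F₁ ∘ₗ F₁ + F₂ ∘ₗ F₂) (-1) = LinearMap.range (F₂ ∘ₗ F₂)) ∧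
    (LinearMap.range (F₂ ∘ₗ F₂) = LinearMap.range F₂) ∧
    (LinearMap.range F₂ = LinearMap.ker F₁) ∧
    (∀ x ∈ eigSpR V (F₁ ∘ₗ F₁ + F₂ ∘ₗ F₂) 1, F₁ (F₁ x) = x) ∧
    (∀ x ∈ eigSpR V (F₁ ∘ₗ F₁ + F₂ ∘ₗ F₂) (-1), F₂ (F₂ x) = - x) := by
  have h4 : F₂ ∘ₗ F₁ = 0 := by rwa [h3, zero_add] at h2
  have a (x : V) : F₁ (F₁ x) - F₂ (F₂ x) = x := LinearMap.congr_fun h1 x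
  have b (x : V) : F₁ (F₂ x) = 0 := LinearMap.congr_fun h3 x
  have c (x : V) : F₂ (F₁ x) = 0 := LinearMap.congr_fun h4 x
  have cube₁ (x : V) : F₁ (F₁ (F₁ x)) = F₁ x := by simpa [c] using a (F₁ x)
  have cube₂ (x : V) : F₂ (F₂ (F₂ x)) = -F₂ x := by
    simpa [b, neg_eq_iff_eq_neg] using a (F₂ x)
  have sq₁ {x : V} (hx : F₂ x = 0) : F₁ (F₁ x) = x := by simpa [hx] using a x
  have sq₂ {x : V} (hx : F₁ x = 0) : F₂ (F₂ x) = -x := by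
    simpa [hx, neg_eq_iff_eq_neg] using a x
  have hP : eigSpR V (F₁ ∘ₗ F₁ + F₂ ∘ₗ F₂) 1 = LinearMap.ker F₂ := by
    ext x
    simp only [mem_eigSpR, LinearMap.mem_ker, LinearMap.add_apply, LinearMap.comp_apply, one_smul]
    refine ⟨fun h => ?_, fun h => by simp [h, sq₁ h]⟩
    have := congrArg F₂ h
    rw [map_add, c, cube₂, zero_add, neg_eq_iff_add_eq_zero, ← two_smul ℝ] at this
    simpa using this
  have hQ : eigSpR V (F₁ ∘ₗ F₁ + F₂ ∘ₗ F₂) (-1) = LinearMap.ker F₁ := by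
    ext x
    simp only [mem_eigSpR, LinearMap.mem_ker, LinearMap.add_apply, LinearMap.comp_apply, neg_smul,
      one_smul]
    refine ⟨fun h => ?_, fun h => by simp [h, sq₂ h]⟩
    have := congrArg F₁ h
    rw [map_add, b, cube₁, add_zero, map_neg, eq_neg_iff_add_eq_zero, ← two_smul ℝ] at this
    simpa using this
  have range₁ : LinearMap.range F₁ = LinearMap.ker F₂ :=
    le_antisymm (LinearMap.range_le_ker_iff.2 h4) fun x hx => ⟨F₁ x, sq₁ hx⟩
  have range₂ : LinearMap.range F₂ = LinearMap.ker F₁ :=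
    le_antisymm (LinearMap.range_le_ker_iff.2 h3) fun x hx => ⟨-F₂ x, by simp [sq₂ hx]⟩
  have range_sq₁ : LinearMap.range (F₁ ∘ₗ F₁) = LinearMap.range F₁ := by
    refine le_antisymm (LinearMap.range_comp_le_range _ _) ?_
    rintro _ ⟨x, rfl⟩
    exact ⟨F₁ x, cube₁ x⟩
  have range_sq₂ : LinearMap.range (F₂ ∘ₗ F₂) = LinearMap.range F₂ := by
    refine le_antisymm (LinearMap.range_comp_le_range _ _) ?_
    rintro _ ⟨x, rfl⟩
    exact ⟨-F₂ x, by simp [cube₂]⟩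
  refine ⟨h4, LinearMap.ext cube₁, LinearMap.ext cube₂, ?_, ?_, by rw [hP, range_sq₁, range₁],
    range_sq₁, range₁, by rw [hQ, range_sq₂, range₂], range_sq₂, range₂,
    fun x hx => sq₁ (hP.le hx), fun x hx => sq₂ (hQ.le hx)⟩
  · ext x
    simpa [b, c, cube₁, cube₂, sub_eq_add_neg] using a x
  · rw [hP, hQ]
    refine isCompl_iff.2 ⟨Submodule.disjoint_def.2 fun x hx₂ hx₁ => ?_,
      codisjoint_iff.2 <| eq_top_iff.2 fun x _ => Submodule.mem_sup.2
        ⟨F₁ (F₁ x), c _, -F₂ (F₂ x), by simp [b], by rw [← sub_eq_add_neg, a]⟩⟩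
    rw [← a x, LinearMap.mem_ker.1 hx₁, LinearMap.mem_ker.1 hx₂]
    simp
end
end

section
/- (Pointwise content of Proposition 4.1.) Let (𝓕, 𝓙) be a generalized almost para-Hermitian structure on a finite-dimensional real vector space V with associated triple (γ₀, ψ, F) and subspaces 𝐇₊, 𝐇₋ ⊆ (V ⊕ V*)^ℂ (𝐇_± = 𝐅_± ∩ 𝐇). Let W ⊆ V be a subspace with inclusion ι, and for a subspace U ⊆ (V ⊕ V*)^ℂ define the pullback ι*U = { (X, η∘ι) ∈ W^ℂ ⊕ (W*)^ℂ : X ∈ W^ℂ and (X, η) ∈ U }. Then the restriction of γ₀ to W is nondegenerate and F(W^ℂ) ⊆ W^ℂ if and only if (W ⊕ W*)^ℂ = ι*𝐇₊ ⊕ ι*𝐇₋ ⊕ ι*conj(𝐇₊) ⊕ ι*conj(𝐇₋) is a direct sum decomposition defining a generalized almost para-Hermitian structure on W (i.e., the three sums ι*𝐇₊ ⊕ ι*conj(𝐇₊), ι*𝐇₋ ⊕ ι*conj(𝐇₋), ι*𝐇₊ ⊕ ι*conj(𝐇₋) are maximal isotropic for the pairing metric of W ⊕ W*); in that case the structure so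 defined on W corresponds to the triple (γ₀|_W, ψ|_W, F|_{W^ℂ}). -/
noncomputable section

open TensorProduct

attribute [local instance 3000] TensorProduct.addCommMonoid TensorProduct.leftModule

variable (V : Type) [AddCommGroup V] [Module ℝ V]

section auxiliary

variable {V}

/-- Complex conjugation on a complexified real module. -/
def conjTensor (M : Type) [AddCommGroup M] [Module ℝ M] : ℂ ⊗[ℝ] M →ₗ[ℝ] ℂ ⊗[ℝ] M :=
  LinearMap.rTensor M Complex.conjAe.toLinearMap

section conj

variable {M N : Type} [AddCommGroup M] [Module ℝ M] [AddCommGroup N] [Module ℝ N]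

@[simp]
theorem conjTensor_tmul (c : ℂ) (m : M) :
    conjTensor M (c ⊗ₜ[ℝ] m) = (starRingEnd ℂ c) ⊗ₜ[ℝ] m := rfl

theorem conjTensor_conjTensor (u : ℂ ⊗[ℝ] M) : conjTensor M (conjTensor M u) = u := by
  induction u using TensorProduct.induction_on with
  | zero => simp
  | tmul c m => simp
  | add x y hx hy => rw [map_add, map_add, hx, hy]

theorem conjTensor_smul (c : ℂ) (u : ℂ ⊗[ℝ] M) :
    conjTensor M (c • u) = (starRingEnd ℂ c) • conjTensor M u := by
  induction u using TensorProduct.induction_on with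
  | zero => simp
  | tmul d m => simp [TensorProduct.smul_tmul']
  | add x y hx hy => rw [smul_add, map_add, map_add, hx, hy, smul_add]

theorem baseChange_conjTensor (f : M →ₗ[ℝ] N) (u : ℂ ⊗[ℝ] M) :
    LinearMap.baseChange ℂ f (conjTensor M u) = conjTensor N (LinearMap.baseChange ℂ f u) := by
  induction u using TensorProduct.induction_on with
  | zero => simp
  | tmul d m => simp
  | add x y hx hy => simp only [map_add, hx, hy]

theorem bilinBaseChange_conjTensor (B : LinearMap.BilinForm ℝ M) (u v : ℂ ⊗[ℝ] M) :
    LinearMap.BilinForm.baseChange ℂ B (conjTensor M u) (conjTensor M v) =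
      starRingEnd ℂ (LinearMap.BilinForm.baseChange ℂ B u v) := by
  induction u using TensorProduct.induction_on with
  | zero => simp
  | add x y hx hy => simp only [map_add, LinearMap.add_apply, hx, hy]
  | tmul c m =>
    induction v using TensorProduct.induction_on with
    | zero => simp
    | add x y hx hy => simp only [map_add, hx, hy]
    | tmul d n => simp

theorem exists_eq_tmul_add_tmul (u : ℂ ⊗[ℝ] M) :
    ∃ a b : M, u = (1 : ℂ) ⊗ₜ[ℝ] a + Complex.I ⊗ₜ[ℝ] b := by
  induction u using TensorProduct.induction_on with
  | zero => exact ⟨0, 0, by simp⟩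
  | tmul c m =>
    refine ⟨c.re • m, c.im • m, ?_⟩
    rw [← TensorProduct.smul_tmul, ← TensorProduct.smul_tmul, ← TensorProduct.add_tmul]
    congr 1
    apply Complex.ext <;> simp
  | add x y hx hy =>
    obtain ⟨a, b, rfl⟩ := hx
    obtain ⟨a', b', rfl⟩ := hy
    refine ⟨a + a', b + b', ?_⟩
    rw [TensorProduct.tmul_add, TensorProduct.tmul_add]
    abel

theorem one_tmul_add_I_tmul_eq_zero {a b : M}
    (h : (1 : ℂ) ⊗ₜ[ℝ] a + Complex.I ⊗ₜ[ℝ] b = 0) : a = 0 ∧ b = 0 := by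
  constructor
  · have := congrArg (TensorProduct.lid ℝ M ∘ LinearMap.rTensor M Complex.reLm) h
    simpa using this
  · have := congrArg (TensorProduct.lid ℝ M ∘ LinearMap.rTensor M Complex.imLm) h
    simpa using this

end conj

theorem bc_ext {u v : Bc V} (h₁ : prV V u = prV V v)
    (h₂ : ∀ Y, gc V u (inV V Y) = gc V v (inV V Y)) : u = v := by
  rw [← sub_eq_zero]
  replace h₁ : prV V (u - v) = 0 := by rw [map_sub, h₁, sub_self]
  replace h₂ : ∀ Y, gc V (u - v) (inV V Y) = 0 := fun Y => by
    rw [map_sub, LinearMap.sub_apply, h₂, sub_self]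
  generalize u - v = w at h₁ h₂
  obtain ⟨⟨a, α⟩, ⟨b, β⟩, rfl⟩ := exists_eq_tmul_add_tmul w
  obtain ⟨rfl, rfl⟩ : a = 0 ∧ b = 0 := one_tmul_add_I_tmul_eq_zero (by simpa [prV] using h₁)
  have h₃ : ∀ y, α y = 0 ∧ β y = 0 := fun y => by
    have := h₂ (1 ⊗ₜ[ℝ] y)
    simpa [gc, inV, gP, Complex.ext_iff] using this
  obtain rfl : α = 0 := LinearMap.ext fun y => (h₃ y).1
  obtain rfl : β = 0 := LinearMap.ext fun y => (h₃ y).2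
  change (1 : ℂ) ⊗ₜ[ℝ] (0 : Big V) + Complex.I ⊗ₜ[ℝ] (0 : Big V) = 0
  simp

theorem gc_eq (u v : Bc V) :
    gc V u v = gc V u (inV V (prV V v)) + gc V v (inV V (prV V u)) := by
  induction u using TensorProduct.induction_on with
  | zero => simp
  | add x y hx hy => simp only [map_add, LinearMap.add_apply, hx, hy]; ring
  | tmul c m =>
    induction v using TensorProduct.induction_on with
    | zero => simp
    | add x y hx hy => simp only [map_add, LinearMap.add_apply, hx, hy]; ring
    | tmul d n =>
      simp [gc, inV, prV, gP]
      ring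

/-- The map `X ↦ (X, ψ^ℂ(X,·) + i γ^ℂ(X,·))` from `V^ℂ` to `(V ⊕ V*)^ℂ`. -/
def graphMap (γ ψ : LinearMap.BilinForm ℝ V) : Vc V →ₗ[ℂ] Bc V :=
  LinearMap.baseChange ℂ (LinearMap.prod LinearMap.id ψ) +
    Complex.I • LinearMap.baseChange ℂ (LinearMap.inr ℝ V (Module.Dual ℝ V) ∘ₗ γ)

theorem prV_graphMap (γ ψ : LinearMap.BilinForm ℝ V) (X : Vc V) :
    prV V (graphMap γ ψ X) = X := by
  induction X using TensorProduct.induction_on with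
  | zero => simp
  | add x y hx hy => simp only [map_add, hx, hy]
  | tmul c m => simp [graphMap, prV]

theorem gc_graphMap_inV (γ ψ : LinearMap.BilinForm ℝ V) (X Y : Vc V) :
    2 * gc V (graphMap γ ψ X) (inV V Y) = bcB V ψ X Y + Complex.I * bcB V γ X Y := by
  induction X using TensorProduct.induction_on with
  | zero => simp
  | add x y hx hy => simp only [map_add, LinearMap.add_apply, mul_add, hx, hy]; ring
  | tmul c m =>
    induction Y using TensorProduct.induction_on with
    | zero => simp
    | add x y hx hy => simp only [map_add, mul_add, hx, hy]; ring
    | tmul d n =>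
      simp [gc, inV, gP, graphMap, bcB]
      ring

theorem graphMap_mem_graphSet (γ ψ : LinearMap.BilinForm ℝ V) (X : Vc V) :
    graphMap γ ψ X ∈ graphSet V γ ψ := fun Y => by
  rw [gc_graphMap_inV, prV_graphMap]

theorem eq_graphMap_of_mem_graphSet {γ ψ : LinearMap.BilinForm ℝ V} {u : Bc V}
    (h : u ∈ graphSet V γ ψ) : u = graphMap γ ψ (prV V u) := by
  refine bc_ext (prV_graphMap _ _ _).symm fun Y => ?_
  have := gc_graphMap_inV γ ψ (prV V u) Y
  rw [← h Y] at this
  exact (mul_left_cancel₀ two_ne_zero this).symm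

theorem bcB_flip {B : LinearMap.BilinForm ℝ V} {c : ℝ} (h : ∀ x y, B x y = c * B y x)
    (X Y : Vc V) : bcB V B X Y = c * bcB V B Y X := by
  induction X using TensorProduct.induction_on with
  | zero => simp
  | add x y hx hy => simp only [map_add, LinearMap.add_apply, mul_add, hx, hy]
  | tmul a m =>
    induction Y using TensorProduct.induction_on with
    | zero => simp
    | add x y hx hy => simp only [map_add, LinearMap.add_apply, mul_add, hx, hy]
    | tmul d n =>
      simp [bcB, h m n]
      ring

theorem bcB_neg (B : LinearMap.BilinForm ℝ V) (X Y : Vc V) :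
    bcB V (-B) X Y = - bcB V B X Y := by
  induction X using TensorProduct.induction_on with
  | zero => simp
  | add x y hx hy => simp only [map_add, LinearMap.add_apply, neg_add, hx, hy]
  | tmul a m =>
    induction Y using TensorProduct.induction_on with
    | zero => simp
    | add x y hx hy => simp only [map_add, neg_add, hx, hy]
    | tmul d n => simp [bcB]

theorem eq_zero_of_bcB {γ : LinearMap.BilinForm ℝ V} (h : ∀ x, (∀ y, γ x y = 0) → x = 0)
    {X : Vc V} (hX : ∀ Y, bcB V γ X Y = 0) : X = 0 := by
  obtain ⟨a, b, rfl⟩ := exists_eq_tmul_add_tmul X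
  have h₃ : ∀ y, γ a y = 0 ∧ γ b y = 0 := fun y => by
    have := hX (1 ⊗ₜ[ℝ] y)
    simpa [bcB, Complex.ext_iff] using this
  obtain rfl := h a fun y => (h₃ y).1
  obtain rfl := h b fun y => (h₃ y).2
  simp

theorem gc_graphMap {γ γ' ψ : LinearMap.BilinForm ℝ V} (hγ : ∀ x y, γ' x y = γ' y x)
    (hψ : ∀ x y, ψ x y = - ψ y x) (X Y : Vc V) :
    2 * gc V (graphMap γ ψ X) (graphMap γ' ψ Y) =
      Complex.I * (bcB V γ X Y + bcB V γ' X Y) := by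
  rw [gc_eq, mul_add, gc_graphMap_inV, gc_graphMap_inV, prV_graphMap, prV_graphMap,
    bcB_flip (c := -1) (by simpa using hψ) Y X, bcB_flip (c := 1) (by simpa using hγ) Y X]
  push_cast
  ring

theorem conjTensor_graphMap (γ ψ : LinearMap.BilinForm ℝ V) (X : Vc V) :
    conjTensor _ (graphMap γ ψ X) = graphMap (-γ) ψ (conjTensor _ X) := by
  induction X using TensorProduct.induction_on with
  | zero => simp
  | add x y hx hy => simp only [map_add, hx, hy]
  | tmul c m =>
    simp [graphMap, TensorProduct.smul_tmul', TensorProduct.neg_tmul]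

theorem mem_conjSub {S : Submodule ℂ (Bc V)} {u : Bc V} :
    u ∈ conjSub V S ↔ conjTensor _ u ∈ S := by
  constructor
  · intro hu
    induction hu using Submodule.span_induction with
    | mem x hx =>
      obtain ⟨y, hy, rfl⟩ := hx
      change conjTensor _ (conjTensor _ y) ∈ S
      rwa [conjTensor_conjTensor]
    | zero => simp
    | add x y _ _ hx hy => rw [map_add]; exact add_mem hx hy
    | smul c x _ hx => rw [conjTensor_smul]; exact S.smul_mem _ hx
  · intro hu
    exact Submodule.subset_span ⟨_, hu, conjTensor_conjTensor u⟩

theorem mem_pullback {W : Submodule ℝ V} {S : Submodule ℂ (Bc V)} {u : Bc W} :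
    u ∈ pullback V W S ↔ ∃ w, LinearMap.baseChange ℂ (bigIncl V W) w ∈ S ∧
      LinearMap.baseChange ℂ (bigRes V W) w = u := Iff.rfl

theorem pullback_conjSub (W : Submodule ℝ V) (S : Submodule ℂ (Bc V)) :
    pullback V W (conjSub V S) = conjSub W (pullback V W S) := by
  ext u
  rw [mem_conjSub, mem_pullback, mem_pullback]
  constructor
  · rintro ⟨w, hw, rfl⟩
    exact ⟨conjTensor _ w, by rwa [baseChange_conjTensor, ← mem_conjSub],
      baseChange_conjTensor _ _⟩
  · rintro ⟨w, hw, hu⟩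
    exact ⟨conjTensor _ w, by rwa [baseChange_conjTensor, mem_conjSub, conjTensor_conjTensor],
      by rw [baseChange_conjTensor, hu, conjTensor_conjTensor]⟩

theorem prV_bigIncl (W : Submodule ℝ V) (w : ℂ ⊗[ℝ] (W × Module.Dual ℝ V)) :
    prV V (LinearMap.baseChange ℂ (bigIncl V W) w) = LinearMap.baseChange ℂ W.subtype
      (prV W (LinearMap.baseChange ℂ (bigRes V W) w)) := by
  induction w using TensorProduct.induction_on with
  | zero => simp
  | add x y hx hy => simp only [map_add, hx, hy]
  | tmul c m => simp [prV, bigIncl, bigRes]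

theorem gc_bigIncl (W : Submodule ℝ V) (w : ℂ ⊗[ℝ] (W × Module.Dual ℝ V)) (Y : Vc W) :
    gc V (LinearMap.baseChange ℂ (bigIncl V W) w)
      (inV V (LinearMap.baseChange ℂ W.subtype Y)) =
    gc W (LinearMap.baseChange ℂ (bigRes V W) w) (inV W Y) := by
  induction w using TensorProduct.induction_on with
  | zero => simp
  | add x y hx hy => simp only [map_add, LinearMap.add_apply, hx, hy]
  | tmul c m =>
    induction Y using TensorProduct.induction_on with
    | zero => simp
    | add x y hx hy => simp only [map_add, hx, hy]
    | tmul d n => simp [gc, inV, gP, bigIncl, bigRes]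

theorem bcB_resB (W : Submodule ℝ V) (B : LinearMap.BilinForm ℝ V) (X Y : Vc W) :
    bcB W (resB V W B) X Y =
      bcB V B (LinearMap.baseChange ℂ W.subtype X) (LinearMap.baseChange ℂ W.subtype Y) := by
  induction X using TensorProduct.induction_on with
  | zero => simp
  | add x y hx hy => simp only [map_add, LinearMap.add_apply, hx, hy]
  | tmul c m =>
    induction Y using TensorProduct.induction_on with
    | zero => simp
    | add x y hx hy => simp only [map_add, hx, hy]
    | tmul d n => simp [bcB, resB]

theorem bigRes_mem_graphSet {W : Submodule ℝ V} {γ ψ : LinearMap.BilinForm ℝ V}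
    {w : ℂ ⊗[ℝ] (W × Module.Dual ℝ V)}
    (hw : LinearMap.baseChange ℂ (bigIncl V W) w ∈ graphSet V γ ψ) :
    LinearMap.baseChange ℂ (bigRes V W) w ∈ graphSet W (resB V W γ) (resB V W ψ) := fun Y => by
  rw [← gc_bigIncl, hw, bcB_resB, bcB_resB, prV_bigIncl]

theorem exists_bigIncl_eq {W : Submodule ℝ V} {v : Bc V} {X : Vc W}
    (h : prV V v = LinearMap.baseChange ℂ W.subtype X) :
    ∃ w, LinearMap.baseChange ℂ (bigIncl V W) w = v ∧
      prV W (LinearMap.baseChange ℂ (bigRes V W) w) = X := by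
  let s := LinearMap.snd ℝ V (Module.Dual ℝ V)
  refine ⟨LinearMap.baseChange ℂ (LinearMap.inl ℝ W (Module.Dual ℝ V)) X +
    LinearMap.baseChange ℂ (LinearMap.inr ℝ W (Module.Dual ℝ V) ∘ₗ s) v, ?_, ?_⟩
  · have h₁ : ∀ X : Vc W, LinearMap.baseChange ℂ (bigIncl V W)
        (LinearMap.baseChange ℂ (LinearMap.inl ℝ W (Module.Dual ℝ V)) X) =
        inV V (LinearMap.baseChange ℂ W.subtype X) := fun X => by
      induction X using TensorProduct.induction_on with
      | zero => simp
      | add x y hx hy => simp only [map_add, hx, hy]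
      | tmul c m => simp [inV, bigIncl]
    rw [map_add, h₁, ← h]
    clear h
    induction v using TensorProduct.induction_on with
    | zero => simp
    | add x y hx hy =>
      conv_rhs => rw [← hx, ← hy]
      simp only [map_add]
      abel
    | tmul c m => simp [inV, prV, bigIncl, s, ← TensorProduct.tmul_add]
  · have h₁ : ∀ v : Bc V, prV W (LinearMap.baseChange ℂ (bigRes V W)
        (LinearMap.baseChange ℂ (LinearMap.inr ℝ W (Module.Dual ℝ V) ∘ₗ s) v)) = 0 := fun v => by
      induction v using TensorProduct.induction_on with
      | zero => simp
      | add x y hx hy => simp only [map_add, hx, hy, add_zero]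
      | tmul c m => simp [prV, bigRes]
    rw [map_add, map_add, h₁, add_zero]
    clear h
    induction X using TensorProduct.induction_on with
    | zero => simp
    | add x y hx hy => simp only [map_add, hx, hy]
    | tmul c m => simp [prV, bigRes]

/-- The `μ`-eigenspace of `F` inside the complexification of `W`. -/
def eigOn (F : Vc V →ₗ[ℂ] Vc V) (W : Submodule ℝ V) (μ : ℂ) : Submodule ℂ (Vc W) :=
  LinearMap.ker ((F - μ • LinearMap.id) ∘ₗ LinearMap.baseChange ℂ W.subtype)

theorem mem_eigOn {F : Vc V →ₗ[ℂ] Vc V} {W : Submodule ℝ V} {μ : ℂ} {X : Vc W} :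
    X ∈ eigOn F W μ ↔ F (LinearMap.baseChange ℂ W.subtype X) =
      μ • LinearMap.baseChange ℂ W.subtype X := by
  simp [eigOn, sub_eq_zero]

theorem mem_eigSp {T : Bc V →ₗ[ℂ] Bc V} {μ : ℂ} {u : Bc V} :
    u ∈ eigSp V T μ ↔ T u = μ • u := Iff.rfl

theorem mem_map_graphMap {γ ψ : LinearMap.BilinForm ℝ V} {A : Submodule ℂ (Vc V)} {u : Bc V} :
    u ∈ A.map (graphMap γ ψ) ↔ u ∈ graphSet V γ ψ ∧ prV V u ∈ A := by
  constructor
  · rintro ⟨X, hX, rfl⟩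
    exact ⟨graphMap_mem_graphSet _ _ _, by rwa [prV_graphMap]⟩
  · rintro ⟨h₁, h₂⟩
    exact ⟨_, h₂, (eq_graphMap_of_mem_graphSet h₁).symm⟩

theorem pullback_eigSp_inf {A : Big V →ₗ[ℝ] Big V} {H : Submodule ℂ (Bc V)}
    {γ ψ : LinearMap.BilinForm ℝ V} (hH : (H : Set (Bc V)) = graphSet V γ ψ)
    (hA : ∀ u ∈ H, LinearMap.baseChange ℂ A u ∈ H) {F : Vc V →ₗ[ℂ] Vc V}
    (hF : ∀ u ∈ H, prV V (LinearMap.baseChange ℂ A u) = F (prV V u))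
    (W : Submodule ℝ V) (μ : ℂ) :
    pullback V W (eigSp V (LinearMap.baseChange ℂ A) μ ⊓ H) =
      (eigOn F W μ).map (graphMap (resB V W γ) (resB V W ψ)) := by
  have hH' : ∀ {u}, u ∈ H ↔ u ∈ graphSet V γ ψ := fun {u} => by rw [← hH]; rfl
  ext u
  rw [mem_pullback, mem_map_graphMap, mem_eigOn]
  constructor
  · rintro ⟨w, ⟨h₁, h₂⟩, rfl⟩
    refine ⟨bigRes_mem_graphSet (hH'.1 h₂), ?_⟩
    rw [← prV_bigIncl, ← hF _ h₂, mem_eigSp.1 h₁, map_smul]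
  · rintro ⟨h₁, h₂⟩
    set v := graphMap γ ψ (LinearMap.baseChange ℂ W.subtype (prV W u)) with hv
    have hvH : v ∈ H := hH'.2 (graphMap_mem_graphSet _ _ _)
    have hpv : prV V v = LinearMap.baseChange ℂ W.subtype (prV W u) := prV_graphMap _ _ _
    obtain ⟨w, hw, hwX⟩ := exists_bigIncl_eq hpv
    refine ⟨w, ?_, ?_⟩
    · rw [hw]
      refine ⟨?_, hvH⟩
      rw [SetLike.mem_coe, mem_eigSp, eq_graphMap_of_mem_graphSet (hH'.1 (hA v hvH)), hF v hvH,
        hpv, h₂, map_smul]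
    · rw [eq_graphMap_of_mem_graphSet h₁, ← hwX]
      exact eq_graphMap_of_mem_graphSet (bigRes_mem_graphSet (hw ▸ hH'.1 hvH))

/-- The conjugate of a complex subspace of `V^ℂ`. -/
def conjVc (A : Submodule ℂ (Vc V)) : Submodule ℂ (Vc V) where
  carrier := {X | conjTensor V X ∈ A}
  add_mem' := fun {a b} ha hb => by
    change conjTensor V (a + b) ∈ A
    rw [map_add]
    exact add_mem ha hb
  zero_mem' := by
    change conjTensor V 0 ∈ A
    simp
  smul_mem' := fun c X hX => by
    change conjTensor V (c • X) ∈ A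
    rw [conjTensor_smul]
    exact A.smul_mem _ hX

theorem mem_conjVc {A : Submodule ℂ (Vc V)} {X : Vc V} :
    X ∈ conjVc A ↔ conjTensor V X ∈ A := Iff.rfl

theorem conjSub_map_graphMap (γ ψ : LinearMap.BilinForm ℝ V) (A : Submodule ℂ (Vc V)) :
    conjSub V (A.map (graphMap γ ψ)) = (conjVc A).map (graphMap (-γ) ψ) := by
  ext u
  rw [mem_conjSub]
  constructor
  · rintro ⟨X, hX, hu⟩
    refine ⟨conjTensor V X, by rwa [SetLike.mem_coe, mem_conjVc, conjTensor_conjTensor], ?_⟩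
    rw [← conjTensor_graphMap, hu, conjTensor_conjTensor]
  · rintro ⟨X, hX, rfl⟩
    refine ⟨conjTensor V X, hX, ?_⟩
    rw [← neg_neg γ, ← conjTensor_graphMap, neg_neg]

theorem eq_zero_of_graphMap_add_eq_zero {γ ψ : LinearMap.BilinForm ℝ V}
    (hγ : ∀ x, (∀ y, γ x y = 0) → x = 0) {X Y : Vc V}
    (h : graphMap γ ψ X + graphMap (-γ) ψ Y = 0) : X = 0 ∧ Y = 0 := by
  have h₁ : X + Y = 0 := by
    have := congrArg (prV V) h
    rwa [map_add, prV_graphMap, prV_graphMap, map_zero] at this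
  obtain rfl : Y = -X := (neg_eq_of_add_eq_zero_right h₁).symm
  have h₂ : X = 0 := eq_zero_of_bcB hγ fun Z => by
    have := congrArg (fun u => 2 * gc V u (inV V Z)) h
    simp only [map_add, LinearMap.add_apply, mul_add, gc_graphMap_inV, map_neg,
      LinearMap.neg_apply, mul_neg, gc_graphMap_inV, bcB_neg, map_zero, LinearMap.zero_apply, mul_zero] at this
    have h₃ : 2 * Complex.I * bcB V γ X Z = 0 := by linear_combination this
    simpa using h₃
  simp [h₂]

theorem nondegenerate_and_sup_eq_top {γ ψ : LinearMap.BilinForm ℝ V}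
    {A B C D : Submodule ℂ (Vc V)} (hγs : ∀ x y, γ x y = γ y x)
    (h : A.map (graphMap γ ψ) ⊔ B.map (graphMap γ ψ) ⊔
      (C.map (graphMap (-γ) ψ) ⊔ D.map (graphMap (-γ) ψ)) = ⊤) :
    (∀ x, (∀ y, γ x y = 0) → x = 0) ∧ A ⊔ B = ⊤ := by
  rw [← Submodule.map_sup, ← Submodule.map_sup] at h
  have key : ∀ u, ∃ X ∈ A ⊔ B, ∃ Y, graphMap γ ψ X + graphMap (-γ) ψ Y = u := fun u => by
    obtain ⟨_, ⟨X, hX, rfl⟩, _, ⟨Y, -, rfl⟩, hu⟩ :=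
      Submodule.mem_sup.1 (h ▸ Submodule.mem_top : u ∈ _)
    exact ⟨X, hX, Y, hu⟩
  have hγ : ∀ x, (∀ y, γ x y = 0) → x = 0 := fun x hx => by
    refine (Module.forall_dual_apply_eq_zero_iff ℝ x).1 fun η => ?_
    obtain ⟨X, -, Y, hXY⟩ := key (1 ⊗ₜ[ℝ] (0, η))
    have h₁ := congrArg (prV V) hXY
    rw [map_add, prV_graphMap, prV_graphMap] at h₁
    obtain rfl : Y = -X := (neg_eq_of_add_eq_zero_right (by simpa [prV] using h₁)).symm
    have hx' : bcB V γ X (1 ⊗ₜ[ℝ] x) = 0 := by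
      clear hXY h₁
      induction X using TensorProduct.induction_on with
      | zero => simp
      | add x y hx hy => simp only [map_add, LinearMap.add_apply, hx, hy, add_zero]
      | tmul c m => simp [bcB, hγs m x, hx]
    have h₂ := congrArg (fun u => 2 * gc V u (inV V (1 ⊗ₜ[ℝ] x))) hXY
    simp only [map_add, LinearMap.add_apply, mul_add, gc_graphMap_inV, map_neg,
      LinearMap.neg_apply, mul_neg, gc_graphMap_inV, bcB_neg, hx'] at h₂
    simpa [gc, inV, gP] using h₂
  refine ⟨hγ, eq_top_iff.2 fun Z _ => ?_⟩
  obtain ⟨X, hX, Y, hXY⟩ := key (graphMap γ ψ Z)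
  have h₁ : graphMap γ ψ (X - Z) + graphMap (-γ) ψ Y = 0 := by
    rw [map_sub, ← hXY]
    abel
  rwa [← sub_eq_zero.1 (eq_zero_of_graphMap_add_eq_zero hγ h₁).1]

theorem finrank_le_of_isotropic [FiniteDimensional ℝ V] {γ : LinearMap.BilinForm ℝ V}
    (hγ : ∀ x, (∀ y, γ x y = 0) → x = 0) {A B : Submodule ℂ (Vc V)} (hAB : A ⊔ B = ⊤)
    (hA : ∀ X ∈ A, ∀ Y ∈ A, bcB V γ X Y = 0) :
    Module.finrank ℂ A ≤ Module.finrank ℂ B := by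
  let f : A →ₗ[ℂ] Module.Dual ℂ B := (bcB V γ).domRestrict₁₂ A B
  rw [← Subspace.dual_finrank_eq (K := ℂ) (V := B)]
  refine LinearMap.finrank_le_finrank_of_injective (f := f) ?_
  refine (injective_iff_map_eq_zero f).2 fun X hX => Subtype.ext ?_
  refine eq_zero_of_bcB hγ fun Y => ?_
  obtain ⟨a, ha, b, hb, rfl⟩ := Submodule.mem_sup.1 (hAB ▸ Submodule.mem_top : Y ∈ A ⊔ B)
  rw [map_add, hA _ X.2 _ ha, zero_add]
  exact LinearMap.congr_fun hX ⟨b, hb⟩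

theorem graphMap_injective (γ ψ : LinearMap.BilinForm ℝ V) :
    Function.Injective (graphMap γ ψ) :=
  Function.LeftInverse.injective (prV_graphMap γ ψ)

theorem finrank_map_sup_map [FiniteDimensional ℝ V] {γ ψ : LinearMap.BilinForm ℝ V}
    (hγ : ∀ x, (∀ y, γ x y = 0) → x = 0) (A C : Submodule ℂ (Vc V)) :
    Module.finrank ℂ ↥(A.map (graphMap γ ψ) ⊔ C.map (graphMap (-γ) ψ)) =
      Module.finrank ℂ A + Module.finrank ℂ C := by
  have h := Submodule.finrank_sup_add_finrank_inf_eq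
    (A.map (graphMap γ ψ)) (C.map (graphMap (-γ) ψ))
  have h₀ : A.map (graphMap γ ψ) ⊓ C.map (graphMap (-γ) ψ) = ⊥ := by
    rw [eq_bot_iff]
    rintro _ ⟨⟨X, -, rfl⟩, ⟨Y, -, hY⟩⟩
    have : graphMap γ ψ X + graphMap (-γ) ψ (-Y) = 0 := by rw [map_neg, hY, add_neg_cancel]
    rw [(eq_zero_of_graphMap_add_eq_zero hγ this).1]
    simp
  rw [h₀, finrank_bot, add_zero] at h
  rw [h, ← (Submodule.equivMapOfInjective _ (graphMap_injective γ ψ) A).finrank_eq,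
    ← (Submodule.equivMapOfInjective _ (graphMap_injective (-γ) ψ) C).finrank_eq]

theorem iSup_fin_four {α : Type*} [CompleteLattice α] (a b c d : α) :
    ⨆ i, (![a, b, c, d] : Fin 4 → α) i = a ⊔ b ⊔ (c ⊔ d) := by
  apply le_antisymm
  · refine iSup_le fun i => ?_
    fin_cases i
    · exact le_sup_left.trans le_sup_left
    · exact le_sup_right.trans le_sup_left
    · exact le_sup_left.trans le_sup_right
    · exact le_sup_right.trans le_sup_right
  · exact sup_le
      (sup_le (le_iSup (![a, b, c, d] : Fin 4 → α) 0) (le_iSup (![a, b, c, d] : Fin 4 → α) 1))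
      (sup_le (le_iSup (![a, b, c, d] : Fin 4 → α) 2) (le_iSup (![a, b, c, d] : Fin 4 → α) 3))

theorem iSupIndep_fin_four {M : Type*} [AddCommGroup M] [Module ℂ M]
    {P Q R S : Submodule ℂ M}
    (h : ∀ p ∈ P, ∀ q ∈ Q, ∀ r ∈ R, ∀ s ∈ S, p + q + (r + s) = 0 →
      p = 0 ∧ q = 0 ∧ r = 0 ∧ s = 0) :
    iSupIndep (![P, Q, R, S] : Fin 4 → Submodule ℂ M) := by
  rw [iSupIndep_iff_finsetSum_eq_zero_imp_eq_zero]
  intro s v hv hsum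
  set w : Fin 4 → M := fun i => if i ∈ s then v i else 0 with hw
  have hwm : ∀ i, w i ∈ (![P, Q, R, S] : Fin 4 → Submodule ℂ M) i := fun i => by
    by_cases hi : i ∈ s
    · simpa [hw, hi] using hv i hi
    · simp [hw, hi]
  have hws : ∑ i, w i = 0 := by
    rw [← hsum, hw, Finset.sum_ite_mem, Finset.univ_inter]
  obtain ⟨h₀, h₁, h₂, h₃⟩ := h _ (hwm 0) _ (hwm 1) _ (hwm 2) _ (hwm 3)
    (by rw [← hws, Fin.sum_univ_four]; abel)
  have hw0 : ∀ i, w i = 0 := fun i => by fin_cases i <;> assumption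
  intro i hi
  simpa [hw, hi] using hw0 i

theorem isIsotropic_map_sup_map {γ ψ : LinearMap.BilinForm ℝ V} (hγs : ∀ x y, γ x y = γ y x)
    (hψ : ∀ x y, ψ x y = - ψ y x) {A C : Submodule ℂ (Vc V)}
    (hA : ∀ X ∈ A, ∀ Y ∈ A, bcB V γ X Y = 0) (hC : ∀ X ∈ C, ∀ Y ∈ C, bcB V γ X Y = 0) :
    IsIsotropic V (A.map (graphMap γ ψ) ⊔ C.map (graphMap (-γ) ψ)) := by
  have hγn : ∀ x y, (-γ) x y = (-γ) y x := fun x y => by simp [hγs x y]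
  intro u hu v hv
  obtain ⟨_, ⟨X, hX, rfl⟩, _, ⟨Y, hY, rfl⟩, rfl⟩ := Submodule.mem_sup.1 hu
  obtain ⟨_, ⟨X', hX', rfl⟩, _, ⟨Y', hY', rfl⟩, rfl⟩ := Submodule.mem_sup.1 hv
  have h₁ := gc_graphMap hγs hψ (γ := γ) X X'
  have h₂ := gc_graphMap hγn hψ (γ := γ) X Y'
  have h₃ := gc_graphMap hγs hψ (γ := -γ) Y X'
  have h₄ := gc_graphMap hγn hψ (γ := -γ) Y Y'
  simp only [bcB_neg, hA X hX X' hX', hC Y hY Y' hY', add_neg_cancel, neg_add_cancel, mul_zero,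
    neg_zero, add_zero, mul_eq_zero, two_ne_zero, false_or] at h₁ h₂ h₃ h₄
  simp [h₁, h₂, h₃, h₄]

theorem finrank_Bc (V : Type) [AddCommGroup V] [Module ℝ V] [FiniteDimensional ℝ V] :
    Module.finrank ℂ (Bc V) = Module.finrank ℝ V + Module.finrank ℝ V := by
  rw [Module.finrank_baseChange, Module.finrank_prod, Subspace.dual_finrank_eq]

theorem conjVc_disjoint {A B : Submodule ℂ (Vc V)} (h : Disjoint A B) :
    Disjoint (conjVc A) (conjVc B) := by
  rw [Submodule.disjoint_def] at h ⊢
  intro X hA hB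
  rw [← conjTensor_conjTensor X, h _ hA hB, map_zero]

theorem conjVc_sup_eq_top {A B : Submodule ℂ (Vc V)} (h : A ⊔ B = ⊤) :
    conjVc A ⊔ conjVc B = ⊤ := by
  refine eq_top_iff.2 fun X _ => ?_
  obtain ⟨a, ha, b, hb, hab⟩ :=
    Submodule.mem_sup.1 (h ▸ Submodule.mem_top : conjTensor V X ∈ A ⊔ B)
  refine Submodule.mem_sup.2 ⟨conjTensor V a, ?_, conjTensor V b, ?_, ?_⟩
  · rwa [mem_conjVc, conjTensor_conjTensor]
  · rwa [mem_conjVc, conjTensor_conjTensor]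
  · rw [← map_add, hab, conjTensor_conjTensor]

theorem bcB_conjVc {γ : LinearMap.BilinForm ℝ V} {A : Submodule ℂ (Vc V)}
    (hA : ∀ X ∈ A, ∀ Y ∈ A, bcB V γ X Y = 0) :
    ∀ X ∈ conjVc A, ∀ Y ∈ conjVc A, bcB V γ X Y = 0 := fun X hX Y hY => by
  have h := hA _ hX _ hY
  unfold bcB at h ⊢
  rw [bilinBaseChange_conjTensor] at h
  simpa using h

theorem decomposition_of_isotropic [FiniteDimensional ℝ V] {γ ψ : LinearMap.BilinForm ℝ V}
    (hγs : ∀ x y, γ x y = γ y x) (hψ : ∀ x y, ψ x y = - ψ y x)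
    (hγ : ∀ x, (∀ y, γ x y = 0) → x = 0) {A B : Submodule ℂ (Vc V)}
    (hdisj : Disjoint A B) (hsup : A ⊔ B = ⊤)
    (hA : ∀ X ∈ A, ∀ Y ∈ A, bcB V γ X Y = 0) (hB : ∀ X ∈ B, ∀ Y ∈ B, bcB V γ X Y = 0) :
    DirectSum.IsInternal
        (![A.map (graphMap γ ψ), B.map (graphMap γ ψ), (conjVc A).map (graphMap (-γ) ψ),
          (conjVc B).map (graphMap (-γ) ψ)] : Fin 4 → Submodule ℂ (Bc V)) ∧
      MaxIsotropic V (A.map (graphMap γ ψ) ⊔ (conjVc A).map (graphMap (-γ) ψ)) ∧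
      MaxIsotropic V (B.map (graphMap γ ψ) ⊔ (conjVc B).map (graphMap (-γ) ψ)) ∧
      MaxIsotropic V (A.map (graphMap γ ψ) ⊔ (conjVc B).map (graphMap (-γ) ψ)) := by
  have hdisj' := conjVc_disjoint hdisj
  have hsup' := conjVc_sup_eq_top hsup
  have hA' := bcB_conjVc hA
  have hB' := bcB_conjVc hB
  have dims : ∀ {C D : Submodule ℂ (Vc V)}, Disjoint C D → C ⊔ D = ⊤ →
      (∀ X ∈ C, ∀ Y ∈ C, bcB V γ X Y = 0) → (∀ X ∈ D, ∀ Y ∈ D, bcB V γ X Y = 0) →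
      2 * Module.finrank ℂ C = Module.finrank ℝ V ∧
        2 * Module.finrank ℂ D = Module.finrank ℝ V := fun {C D} h₁ h₂ h₃ h₄ => by
    have h₅ := finrank_le_of_isotropic hγ h₂ h₃
    have h₆ := finrank_le_of_isotropic hγ (sup_comm C D ▸ h₂) h₄
    have h₇ := Submodule.finrank_sup_add_finrank_inf_eq C D
    rw [h₂, h₁.eq_bot, finrank_bot, finrank_top, Module.finrank_baseChange] at h₇
    omega
  obtain ⟨dA, dB⟩ := dims hdisj hsup hA hB
  obtain ⟨dA', dB'⟩ := dims hdisj' hsup' hA' hB'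
  refine ⟨?_, ⟨isIsotropic_map_sup_map hγs hψ hA hA', ?_⟩,
    ⟨isIsotropic_map_sup_map hγs hψ hB hB', ?_⟩, ⟨isIsotropic_map_sup_map hγs hψ hA hB', ?_⟩⟩
  · refine DirectSum.isInternal_submodule_of_iSupIndep_of_iSup_eq_top
      (iSupIndep_fin_four ?_) ?_
    · rintro _ ⟨a, ha, rfl⟩ _ ⟨b, hb, rfl⟩ _ ⟨c, hc, rfl⟩ _ ⟨d, hd, rfl⟩ h
      rw [← map_add, ← map_add] at h
      obtain ⟨h₁, h₂⟩ := eq_zero_of_graphMap_add_eq_zero hγ h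
      have zero : ∀ {C D : Submodule ℂ (Vc V)}, Disjoint C D → ∀ x ∈ C, ∀ y ∈ D, x + y = 0 →
          x = 0 ∧ y = 0 := fun {C D} hCD x hx y hy hxy => by
        obtain rfl : y = -x := (neg_eq_of_add_eq_zero_right hxy).symm
        have := Submodule.disjoint_def.1 hCD x hx (by simpa using hy)
        simp [this]
      obtain ⟨rfl, rfl⟩ := zero hdisj a ha b hb h₁
      obtain ⟨rfl, rfl⟩ := zero hdisj' c hc d hd h₂
      simp
    · rw [iSup_fin_four, ← Submodule.map_sup, ← Submodule.map_sup, hsup, hsup']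
      apply Submodule.eq_top_of_finrank_eq
      rw [finrank_map_sup_map hγ, finrank_Bc, finrank_top, Module.finrank_baseChange]
  all_goals
    rw [finrank_map_sup_map hγ]
    omega

theorem baseChange_mem_Hsp {A J : Big V →ₗ[ℝ] Big V} (h : A ∘ₗ J = J ∘ₗ A) {u : Bc V}
    (hu : u ∈ Hsp V J) : LinearMap.baseChange ℂ A u ∈ Hsp V J := by
  rw [Hsp, mem_eigSp] at hu ⊢
  rw [← LinearMap.comp_apply, ← LinearMap.baseChange_comp, ← h, LinearMap.baseChange_comp,
    LinearMap.comp_apply, hu, map_smul]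

section eigenvectors

variable {A : Big V →ₗ[ℝ] Big V} {H : Submodule ℂ (Bc V)} {γ ψ : LinearMap.BilinForm ℝ V}
  {F : Vc V →ₗ[ℂ] Vc V}

theorem apply_apply_eq_self (hH : (H : Set (Bc V)) = graphSet V γ ψ)
    (hA2 : A ∘ₗ A = LinearMap.id) (hA : ∀ u ∈ H, LinearMap.baseChange ℂ A u ∈ H)
    (hF : ∀ u ∈ H, prV V (LinearMap.baseChange ℂ A u) = F (prV V u)) (X : Vc V) :
    F (F X) = X := by
  have hX : graphMap γ ψ X ∈ H := by
    rw [← SetLike.mem_coe, hH]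
    exact graphMap_mem_graphSet _ _ _
  have h := hF _ (hA _ hX)
  rw [hF _ hX, prV_graphMap, ← LinearMap.comp_apply (LinearMap.baseChange ℂ A),
    ← LinearMap.baseChange_comp, hA2, LinearMap.baseChange_id, LinearMap.id_apply,
    prV_graphMap] at h
  exact h.symm

theorem gc_baseChange_skew (hg : ∀ u v, gP V (A u) v = - gP V u (A v)) (u v : Bc V) :
    gc V (LinearMap.baseChange ℂ A u) v = - gc V u (LinearMap.baseChange ℂ A v) := by
  induction u using TensorProduct.induction_on with
  | zero => simp
  | add x y hx hy => simp only [map_add, LinearMap.add_apply, neg_add, hx, hy]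
  | tmul c m =>
    induction v using TensorProduct.induction_on with
    | zero => simp
    | add x y hx hy => simp only [map_add, neg_add, hx, hy]
    | tmul d n => simp [gc, hg m n]

theorem bcB_eq_zero_of_eigenvector (hH : (H : Set (Bc V)) = graphSet V γ ψ)
    (hγs : ∀ x y, γ x y = γ y x) (hψ : ∀ x y, ψ x y = - ψ y x)
    (hg : ∀ u v, gP V (A u) v = - gP V u (A v))
    (hA : ∀ u ∈ H, LinearMap.baseChange ℂ A u ∈ H)
    (hF : ∀ u ∈ H, prV V (LinearMap.baseChange ℂ A u) = F (prV V u)) {μ : ℂ} (hμ : μ ≠ 0)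
    {X Y : Vc V} (hX : F X = μ • X) (hY : F Y = μ • Y) : bcB V γ X Y = 0 := by
  have eig : ∀ X, F X = μ • X →
      LinearMap.baseChange ℂ A (graphMap γ ψ X) = μ • graphMap γ ψ X := fun X hX => by
    have hXH : graphMap γ ψ X ∈ H := by
      rw [← SetLike.mem_coe, hH]
      exact graphMap_mem_graphSet _ _ _
    have h := hA _ hXH
    rw [← SetLike.mem_coe, hH] at h
    rw [eq_graphMap_of_mem_graphSet h, hF _ hXH, prV_graphMap, hX, map_smul]
  have h₁ := gc_baseChange_skew hg (graphMap γ ψ X) (graphMap γ ψ Y)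
  rw [eig X hX, eig Y hY, map_smul, map_smul, LinearMap.smul_apply, smul_eq_mul] at h₁
  have h₂ := gc_graphMap hγs hψ (γ := γ) X Y
  have h₃ : (2 * μ * Complex.I) * bcB V γ X Y = 0 := by linear_combination h₁ - μ * h₂
  simpa [hμ] using h₃

end eigenvectors

theorem baseChange_subtype_injective (W : Submodule ℝ V) :
    Function.Injective (LinearMap.baseChange ℂ W.subtype) :=
  Module.Flat.lTensor_preserves_injective_linearMap W.subtype W.injective_subtype

theorem eigOn_disjoint (F : Vc V →ₗ[ℂ] Vc V) (W : Submodule ℝ V) :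
    Disjoint (eigOn F W 1) (eigOn F W (-1)) := by
  rw [Submodule.disjoint_def]
  intro X h₁ h₂
  rw [mem_eigOn] at h₁ h₂
  have h : LinearMap.baseChange ℂ W.subtype X = 0 := by
    rw [h₁, one_smul] at h₂
    have h₃ : (2 : ℂ) • LinearMap.baseChange ℂ W.subtype X = 0 := by
      rw [two_smul]
      nth_rewrite 1 [h₂]
      rw [neg_one_smul, neg_add_cancel]
    exact (smul_eq_zero.1 h₃).resolve_left two_ne_zero
  exact baseChange_subtype_injective W (h.trans (map_zero _).symm)

theorem eigOn_sup_eq_top {F : Vc V →ₗ[ℂ] Vc V} {W : Submodule ℝ V} (hF : ∀ X, F (F X) = X)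
    (hW : ∀ w : Vc W, F (LinearMap.baseChange ℂ W.subtype w) ∈
      LinearMap.range (LinearMap.baseChange ℂ W.subtype)) :
    eigOn F W 1 ⊔ eigOn F W (-1) = ⊤ := by
  refine eq_top_iff.2 fun X _ => ?_
  obtain ⟨Y, hY⟩ := hW X
  refine Submodule.mem_sup.2 ⟨(1 / 2 : ℂ) • (X + Y), ?_, (1 / 2 : ℂ) • (X - Y), ?_, ?_⟩
  · rw [mem_eigOn, map_smul, map_smul, map_add, map_add, hY, hF]
    module
  · rw [mem_eigOn, map_smul, map_smul, map_sub, map_sub, hY, hF]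
    module
  · module

end auxiliary

/-- pointwise content of Proposition 4.1. Let `(𝓕, 𝓙)` be a
generalized almost para-Hermitian structure on `V` with associated triple `(γ₀, ψ, F)`
and subspaces `𝐇₊ = 𝐅₊ ∩ 𝐇`, `𝐇₋ = 𝐅₋ ∩ 𝐇`, and let `W ⊆ V` be a subspace. Then `γ₀`
restricts nondegenerately to `W` and `F(W^ℂ) ⊆ W^ℂ` iff the pullbacks of `𝐇₊`, `𝐇₋` and
their conjugates give a direct sum decomposition of `(W ⊕ W*)^ℂ` whose three relevant
sums are maximal isotropic for the pairing metric of `W ⊕ W*`; and in that case the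
induced structure corresponds to the triple `(γ₀|_W, ψ|_W, F|_{W^ℂ})`. -/
theorem induced_structure_on_subspace (V : Type) [AddCommGroup V] [Module ℝ V]
    [FiniteDimensional ℝ V]
    (𝓕 𝓙 : Big V →ₗ[ℝ] Big V) (h : IsGAPH V 𝓕 𝓙)
    (γ₀ ψ : LinearMap.BilinForm ℝ V)
    (hsym : ∀ x y, γ₀ x y = γ₀ y x) (hnd : ∀ x, (∀ y, γ₀ x y = 0) → x = 0)
    (hanti : ∀ x y, ψ x y = - ψ y x)
    (F : Vc V →ₗ[ℂ] Vc V)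
    (hgraph : (Hsp V (𝓙 ∘ₗ 𝓕) : Set (Bc V)) = graphSet V γ₀ ψ)
    (hFchar : ∀ u ∈ Hsp V (𝓙 ∘ₗ 𝓕), prV V (LinearMap.baseChange ℂ 𝓕 u) = F (prV V u))
    (W : Submodule ℝ V) :
    ∀ Hp Hm : Submodule ℂ (Bc V),
      Hp = Fplus V 𝓕 ⊓ Hsp V (𝓙 ∘ₗ 𝓕) → Hm = Fminus V 𝓕 ⊓ Hsp V (𝓙 ∘ₗ 𝓕) →
      (((∀ x : ↥W, (∀ y : ↥W, resB V W γ₀ x y = 0) → x = 0) ∧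
        (∀ w : Vc ↥W, F (LinearMap.baseChange ℂ W.subtype w) ∈
          LinearMap.range (LinearMap.baseChange ℂ W.subtype))) ↔
       (DirectSum.IsInternal
          (![pullback V W Hp, pullback V W Hm,
            pullback V W (conjSub V Hp), pullback V W (conjSub V Hm)] :
            Fin 4 → Submodule ℂ (Bc ↥W)) ∧
        MaxIsotropic ↥W (pullback V W Hp ⊔ pullback V W (conjSub V Hp)) ∧
        MaxIsotropic ↥W (pullback V W Hm ⊔ pullback V W (conjSub V Hm)) ∧
        MaxIsotropic ↥W (pullback V W Hp ⊔ pullback V W (conjSub V Hm)))) ∧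
      (((∀ x : ↥W, (∀ y : ↥W, resB V W γ₀ x y = 0) → x = 0) ∧
        (∀ w : Vc ↥W, F (LinearMap.baseChange ℂ W.subtype w) ∈
          LinearMap.range (LinearMap.baseChange ℂ W.subtype))) →
       ((pullback V W Hp : Set (Bc ↥W)) =
          {u | u ∈ graphSet ↥W (resB V W γ₀) (resB V W ψ) ∧
            F (LinearMap.baseChange ℂ W.subtype (prV ↥W u)) =
              LinearMap.baseChange ℂ W.subtype (prV ↥W u)} ∧
        (pullback V W Hm : Set (Bc ↥W)) =
          {u | u ∈ graphSet ↥W (resB V W γ₀) (resB V W ψ) ∧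
            F (LinearMap.baseChange ℂ W.subtype (prV ↥W u)) =
              - LinearMap.baseChange ℂ W.subtype (prV ↥W u)})) := by
  rintro Hp Hm rfl rfl
  obtain ⟨⟨hF2, hFg⟩, -, hFJ, -⟩ := h
  have hinv : ∀ u ∈ Hsp V (𝓙 ∘ₗ 𝓕), LinearMap.baseChange ℂ 𝓕 u ∈ Hsp V (𝓙 ∘ₗ 𝓕) :=
    fun u hu => baseChange_mem_Hsp (by rw [← LinearMap.comp_assoc, hFJ]) hu
  have hp : pullback V W (Fplus V 𝓕 ⊓ Hsp V (𝓙 ∘ₗ 𝓕)) =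
      (eigOn F W 1).map (graphMap (resB V W γ₀) (resB V W ψ)) :=
    pullback_eigSp_inf hgraph hinv hFchar W 1
  have hm : pullback V W (Fminus V 𝓕 ⊓ Hsp V (𝓙 ∘ₗ 𝓕)) =
      (eigOn F W (-1)).map (graphMap (resB V W γ₀) (resB V W ψ)) :=
    pullback_eigSp_inf hgraph hinv hFchar W (-1)
  have hs : ∀ x y, resB V W γ₀ x y = resB V W γ₀ y x := fun x y => hsym x y
  have ha : ∀ x y, resB V W ψ x y = - resB V W ψ y x := fun x y => hanti x y
  rw [pullback_conjSub, pullback_conjSub, hp, hm, conjSub_map_graphMap, conjSub_map_graphMap]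
  refine ⟨⟨?_, ?_⟩, fun _ => ⟨?_, ?_⟩⟩
  · rintro ⟨hγ, hFW⟩
    have hFF : ∀ X, F (F X) = X := apply_apply_eq_self hgraph hF2 hinv hFchar
    have hiso : ∀ μ : ℂ, μ ≠ 0 → ∀ X ∈ eigOn F W μ, ∀ Y ∈ eigOn F W μ,
        bcB W (resB V W γ₀) X Y = 0 := fun μ hμ X hX Y hY => by
      rw [bcB_resB]
      exact bcB_eq_zero_of_eigenvector hgraph hsym hanti hFg hinv hFchar hμ
        (mem_eigOn.1 hX) (mem_eigOn.1 hY)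
    exact decomposition_of_isotropic hs ha hγ (eigOn_disjoint F W) (eigOn_sup_eq_top hFF hFW)
      (hiso 1 one_ne_zero) (hiso (-1) (neg_ne_zero.2 one_ne_zero))
  · rintro ⟨hint, -⟩
    have htop := hint.submodule_iSup_eq_top
    rw [iSup_fin_four] at htop
    obtain ⟨hγ, hAB⟩ := nondegenerate_and_sup_eq_top hs htop
    refine ⟨hγ, fun w => ?_⟩
    obtain ⟨a, ha, b, hb, rfl⟩ := Submodule.mem_sup.1 (hAB ▸ Submodule.mem_top : w ∈ _ ⊔ _)
    rw [map_add, map_add, mem_eigOn.1 ha, mem_eigOn.1 hb, ← map_smul, ← map_smul, ← map_add]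
    exact LinearMap.mem_range_self _ _
  · ext u
    rw [SetLike.mem_coe, mem_map_graphMap, mem_eigOn, one_smul]
    rfl
  · ext u
    rw [SetLike.mem_coe, mem_map_graphMap, mem_eigOn, neg_one_smul]
    rfl
end
end
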